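/- arXiv:2309.10405 — 5 statements merged into one kernel-verified Lean document; each statement's English description precedes it below -/
import Mathlib

section
/- Let a_1, ..., a_n and b be real numbers with n ≥ 2. If ∑_{i=1}^n a_i² ≤ ((∑_{i=1}^n a_i)² − b)/(n − 1), then 2·a_i·a_j ≥ b/(n − 1) for every pair of indices i, j ∈ {1, ..., n} with i ≠ j. -/
/-- Cauchy–Schwarz after merging two of the `n` numbers into their sum. -/
theorem sq_sum_le_card_sub_one_mul {ι : Type*} [Fintype ι] [DecidableEq ι] (a : ι → ℝ)
    {i j : ι} (hij : i ≠ j) :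
    (∑ k, a k) ^ 2 ≤ ((Fintype.card ι : ℝ) - 1) * (∑ k, a k ^ 2 + 2 * a i * a j) := by
  have hi : i ∈ Finset.univ.erase j := Finset.mem_erase.2 ⟨hij, Finset.mem_univ i⟩
  have hcs := sq_sum_le_card_mul_sum_sq (s := Finset.univ.erase j)
    (f := fun k => a k + if k = i then a j else 0)
  have hcard : ((Finset.univ.erase j).card : ℝ) = (Fintype.card ι : ℝ) - 1 := by
    rw [Finset.cast_card_erase_of_mem (Finset.mem_univ j), Finset.card_univ]
  have hsum : ∑ k ∈ Finset.univ.erase j, (a k + if k = i then a j else 0) = ∑ k, a k := by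
    rw [Finset.sum_add_distrib, Finset.sum_ite_eq' _ i, if_pos hi,
      Finset.sum_erase_add _ _ (Finset.mem_univ j)]
  have hsq : ∑ k ∈ Finset.univ.erase j, (a k + if k = i then a j else 0) ^ 2
      = ∑ k, a k ^ 2 + 2 * a i * a j := by
    have hterm : ∀ k, (a k + if k = i then a j else 0) ^ 2
        = a k ^ 2 + if k = i then 2 * a i * a j + a j ^ 2 else 0 := by
      intro k
      split_ifs with hk
      · subst hk; ring
      · ring
    simp only [hterm]
    rw [Finset.sum_add_distrib, Finset.sum_ite_eq' _ i, if_pos hi,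
      ← Finset.sum_erase_add _ (fun k => a k ^ 2) (Finset.mem_univ j)]
    ring
  rwa [hcard, hsum, hsq] at hcs


/-- Chen's algebraic lemma: if `∑ aᵢ² ≤ ((∑ aᵢ)² - b)/(n-1)`, then
`2 aᵢ aⱼ ≥ b/(n-1)` for all `i ≠ j`. -/
theorem chen_lemma (n : ℕ) (hn : 2 ≤ n) (a : Fin n → ℝ) (b : ℝ)
    (h : ∑ i, (a i) ^ 2 ≤ ((∑ i, a i) ^ 2 - b) / ((n : ℝ) - 1)) :
    ∀ i j : Fin n, i ≠ j → 2 * a i * a j ≥ b / ((n : ℝ) - 1) := by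
  intro i j hij
  have hn' : (2 : ℝ) ≤ n := by exact_mod_cast hn
  have hpos : (0 : ℝ) < (n : ℝ) - 1 := by linarith
  have hcs := sq_sum_le_card_sub_one_mul a hij
  rw [Fintype.card_fin] at hcs
  rw [le_div_iff₀ hpos] at h
  rw [ge_iff_le, div_le_iff₀ hpos]
  linarith
end

section
/- Let I ⊆ ℝ be an interval and let f : I → ℝ be a twice continuously differentiable positive function satisfying (f'(t))² + f(t)·f''(t) + 1 = 0 for all t ∈ I. Then there exist constants c₁, c₂ ∈ ℝ such that f(t)² = 2c₁t − t² + c₂ for all t ∈ I; consequently the rotational boundary {(x₁, x₂, y) : x₁² + x₂² = f(y)²} is a round sphere x₁² + x₂² + (y − c₁)² = c₂ + c₁². -/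
/-- A function with vanishing derivative on an open preconnected set of reals is constant there. -/
theorem exists_const_of_hasDerivAt_zero {g : ℝ → ℝ} {I : Set ℝ} (hI : IsOpen I)
    (hconn : IsPreconnected I) (hg : ∀ t ∈ I, HasDerivAt g 0 t) :
    ∃ c, ∀ t ∈ I, g t = c :=
  hI.exists_is_const_of_deriv_eq_zero hconn
    (fun t ht => (hg t ht).differentiableAt.differentiableWithinAt)
    (fun t ht => (hg t ht).deriv)

/-- Equality case of the rotational condition: if `(f')² + f f'' + 1 = 0` on an
interval `I`, then `f(t)² = 2 c₁ t - t² + c₂` on `I`, so the rotational boundary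
`x₁² + x₂² = f(y)²` is the round sphere `x₁² + x₂² + (y - c₁)² = c₂ + c₁²`. -/
theorem rotational_equality_is_sphere (f : ℝ → ℝ) (I : Set ℝ)
    (hI : IsOpen I) (hconn : I.OrdConnected)
    (hf : ContDiffOn ℝ 2 f I) (hpos : ∀ t ∈ I, 0 < f t)
    (heq : ∀ t ∈ I, (deriv f t) ^ 2 + f t * deriv (deriv f) t + 1 = 0) :
    ∃ c₁ c₂ : ℝ,
      (∀ t ∈ I, (f t) ^ 2 = 2 * c₁ * t - t ^ 2 + c₂) ∧
      (∀ x₁ x₂ y : ℝ, y ∈ I → x₁ ^ 2 + x₂ ^ 2 = (f y) ^ 2 →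
        x₁ ^ 2 + x₂ ^ 2 + (y - c₁) ^ 2 = c₂ + c₁ ^ 2) := by
  have hf' : ∀ t ∈ I, HasDerivAt f (deriv f t) t := fun t ht =>
    ((hf.differentiableOn (by norm_num)).differentiableAt (hI.mem_nhds ht)).hasDerivAt
  have hf'' : ∀ t ∈ I, HasDerivAt (deriv f) (deriv (deriv f) t) t := fun t ht =>
    (((hf.deriv_of_isOpen hI (m := 1) (by norm_num)).differentiableOn
      (by norm_num)).differentiableAt (hI.mem_nhds ht)).hasDerivAt
  obtain ⟨c₁, hc₁⟩ := exists_const_of_hasDerivAt_zero (g := fun t => f t * deriv f t + t)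
    hI hconn.isPreconnected fun t ht => by
      refine (((hf' t ht).mul (hf'' t ht)).add (hasDerivAt_id t)).congr_deriv ?_
      linear_combination heq t ht
  obtain ⟨c₂, hc₂⟩ := exists_const_of_hasDerivAt_zero
    (g := fun t => f t ^ 2 + t ^ 2 - 2 * c₁ * t) hI hconn.isPreconnected fun t ht => by
      refine ((((hf' t ht).pow 2).add ((hasDerivAt_id t).pow 2)).sub
        ((hasDerivAt_id t).const_mul (2 * c₁))).congr_deriv ?_
      simp only [id]
      push_cast
      linear_combination 2 * hc₁ t ht
  refine ⟨c₁, c₂, fun t ht => by linear_combination hc₂ t ht, fun x₁ x₂ y hy hxy => ?_⟩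
  linear_combination hxy + hc₂ y hy
end

section
/- Fix H > 0 and 0 < B < 1, let x(s) = (1/H)·√(1 + B² + 2B·sin(Hs + 3π/2)) and z(s) = ∫_{3π/(2H)}^{s + 3π/(2H)} (1 + B·sin(Ht))/√(1 + B² + 2B·sin(Ht)) dt, and set s₀ = (1/H)·arcsin(−B) + π/(2H). Then z'(s) > 0 for all s ∈ ℝ, x''(s₀) = 0, s₀ is the smallest positive zero of x'', and x''(s) > 0 for all s ∈ (−s₀, s₀). -/
open Real

/-- Kenmotsu's profile function `x(s) = (1/H)√(1 + B² + 2B sin(Hs + 3π/2))`. -/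
noncomputable def kenX (H B : ℝ) (s : ℝ) : ℝ :=
  (1 / H) * Real.sqrt (1 + B ^ 2 + 2 * B * Real.sin (H * s + 3 * Real.pi / 2))

/-- Kenmotsu's height function
`z(s) = ∫_{3π/(2H)}^{s + 3π/(2H)} (1 + B sin(Ht))/√(1 + B² + 2B sin(Ht)) dt`. -/
noncomputable def kenZ (H B : ℝ) (s : ℝ) : ℝ :=
  ∫ t in (3 * Real.pi / (2 * H))..(s + 3 * Real.pi / (2 * H)),
    (1 + B * Real.sin (H * t)) / Real.sqrt (1 + B ^ 2 + 2 * B * Real.sin (H * t))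

/-- The quantity under the square root is positive when `|B| < 1`. -/
lemma one_add_sq_add_two_mul_mul_sin_pos {B : ℝ} (hB : |B| < 1) (t : ℝ) :
    0 < 1 + B ^ 2 + 2 * B * sin t := by
  have hsq : B ^ 2 < 1 := (sq_lt_one_iff_abs_lt_one B).2 hB
  nlinarith [sq_nonneg (B + sin t), sin_sq_le_one t]

lemma one_add_sq_sub_two_mul_mul_cos_pos {B : ℝ} (hB : |B| < 1) (t : ℝ) :
    0 < 1 + B ^ 2 - 2 * B * cos t := by
  have h := one_add_sq_add_two_mul_mul_sin_pos hB (t - π / 2)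
  rw [sin_sub_pi_div_two] at h
  linarith

lemma one_sub_mul_cos_pos {B : ℝ} (hB : |B| < 1) (t : ℝ) : 0 < 1 - B * cos t := by
  have h : |B * cos t| < 1 := by
    rw [abs_mul]
    exact (mul_le_of_le_one_right (abs_nonneg B) (abs_cos_le_one t)).trans_lt hB
  linarith [(abs_lt.1 h).2]

lemma kenX_eq_cos (H B : ℝ) :
    kenX H B = fun s => (1 / H) * √(1 + B ^ 2 - 2 * B * cos (H * s)) := by
  funext s
  have h : sin (H * s + 3 * π / 2) = -cos (H * s) := by
    rw [show H * s + 3 * π / 2 = H * s + π / 2 + π by ring, sin_add_pi, sin_add_pi_div_two]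
  rw [kenX, h]
  ring_nf

lemma hasDerivAt_one_add_sq_sub_two_mul_mul_cos (H B s : ℝ) :
    HasDerivAt (fun s => 1 + B ^ 2 - 2 * B * cos (H * s)) (2 * B * H * sin (H * s)) s := by
  have h := (((hasDerivAt_id' s).const_mul H).cos.const_mul (2 * B)).const_sub (1 + B ^ 2)
  exact h.congr_deriv (by ring)

lemma deriv_kenX {H B : ℝ} (hH : H ≠ 0) (hB : |B| < 1) :
    deriv (kenX H B) = fun s => B * sin (H * s) / √(1 + B ^ 2 - 2 * B * cos (H * s)) := by
  funext s
  have hQ := one_add_sq_sub_two_mul_mul_cos_pos hB (H * s)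
  have h := ((hasDerivAt_one_add_sq_sub_two_mul_mul_cos H B s).sqrt hQ.ne').const_mul (1 / H)
  rw [kenX_eq_cos, h.deriv]
  have := (sqrt_pos.2 hQ).ne'
  field_simp

/-- The sign of `x''` is that of `B H (cos (H s) - B)`. -/
lemma deriv_deriv_kenX {H B : ℝ} (hH : H ≠ 0) (hB : |B| < 1) (s : ℝ) :
    deriv (deriv (kenX H B)) s = B * H * (cos (H * s) - B) *
      ((1 - B * cos (H * s)) / √(1 + B ^ 2 - 2 * B * cos (H * s)) ^ 3) := by
  have hQ := one_add_sq_sub_two_mul_mul_cos_pos hB (H * s)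
  have hR := (sqrt_pos.2 hQ).ne'
  have h := ((((hasDerivAt_id' s).const_mul H).sin.const_mul B)).div
    ((hasDerivAt_one_add_sq_sub_two_mul_mul_cos H B s).sqrt hQ.ne') hR
  rw [deriv_kenX hH hB]
  refine h.deriv.trans ?_
  have hsq := sq_sqrt hQ.le
  generalize √(1 + B ^ 2 - 2 * B * cos (H * s)) = R at *
  field_simp
  rw [hsq, sin_sq]
  ring

lemma hasDerivAt_kenZ {B : ℝ} (H : ℝ) (hB : |B| < 1) (s : ℝ) :
    HasDerivAt (kenZ H B)
      ((1 + B * sin (H * (s + 3 * π / (2 * H)))) /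
        √(1 + B ^ 2 + 2 * B * sin (H * (s + 3 * π / (2 * H))))) s := by
  have hc : Continuous fun t => (1 + B * sin (H * t)) / √(1 + B ^ 2 + 2 * B * sin (H * t)) :=
    Continuous.div (by fun_prop) (by fun_prop) fun t =>
      (sqrt_pos.2 (one_add_sq_add_two_mul_mul_sin_pos hB (H * t))).ne'
  exact HasDerivAt.comp_add_const s (3 * π / (2 * H))
    (hc.integral_hasStrictDerivAt (3 * π / (2 * H)) (s + 3 * π / (2 * H))).hasDerivAt

lemma deriv_kenZ_pos {B : ℝ} (H : ℝ) (hB : |B| < 1) (s : ℝ) : 0 < deriv (kenZ H B) s := by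
  rw [(hasDerivAt_kenZ H hB s).deriv]
  refine div_pos ?_ (sqrt_pos.2 (one_add_sq_add_two_mul_mul_sin_pos hB _))
  rw [← cos_pi_div_two_sub, ← neg_neg B, neg_mul, ← sub_eq_add_neg]
  exact one_sub_mul_cos_pos (by rwa [abs_neg]) _

/-- For the unduloid (`0 < B < 1`): `z' > 0` everywhere, and
`s₀ = (1/H) arcsin(-B) + π/(2H)` is the smallest positive zero of `x''`,
with `x'' > 0` on `(-s₀, s₀)`. -/
theorem unduloid_basic_properties (H B : ℝ) (hH : 0 < H) (hB0 : 0 < B)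
    (hB1 : B < 1) :
    (∀ s : ℝ, 0 < deriv (kenZ H B) s) ∧
    0 < (1 / H) * Real.arcsin (-B) + Real.pi / (2 * H) ∧
    deriv (deriv (kenX H B)) ((1 / H) * Real.arcsin (-B) + Real.pi / (2 * H)) = 0 ∧
    (∀ s : ℝ, 0 < s → deriv (deriv (kenX H B)) s = 0 →
      (1 / H) * Real.arcsin (-B) + Real.pi / (2 * H) ≤ s) ∧
    (∀ s ∈ Set.Ioo (-((1 / H) * Real.arcsin (-B) + Real.pi / (2 * H)))
        ((1 / H) * Real.arcsin (-B) + Real.pi / (2 * H)),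
      0 < deriv (deriv (kenX H B)) s) := by
  have hB : |B| < 1 := abs_lt.2 ⟨by linarith, hB1⟩
  have hs : (1 / H) * arcsin (-B) + π / (2 * H) = arccos B / H := by
    rw [arcsin_neg, arccos]
    field_simp
    ring
  have hpos : ∀ s ∈ Set.Ioo (-(arccos B / H)) (arccos B / H),
      0 < deriv (deriv (kenX H B)) s := by
    intro s hs
    have habs : |H * s| < arccos B := by
      rw [abs_mul, abs_of_pos hH, mul_comm]
      exact (lt_div_iff₀ hH).1 (abs_lt.2 hs)
    have hcos : B < cos (H * s) := by
      rw [← cos_abs, ← cos_arccos (by linarith : -1 ≤ B) hB1.le]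
      exact cos_lt_cos_of_nonneg_of_le_pi (abs_nonneg _) (arccos_le_pi B) habs
    rw [deriv_deriv_kenX hH.ne' hB]
    exact mul_pos (mul_pos (mul_pos hB0 hH) (sub_pos.2 hcos))
      (div_pos (one_sub_mul_cos_pos hB _)
        (pow_pos (sqrt_pos.2 (one_add_sq_sub_two_mul_mul_cos_pos hB _)) 3))
  have hs0 : 0 < arccos B / H := div_pos (arccos_pos.2 hB1) hH
  rw [hs]
  refine ⟨deriv_kenZ_pos H hB, hs0, ?_, fun s h0 hzero => ?_, hpos⟩
  · rw [deriv_deriv_kenX hH.ne' hB, mul_div_cancel₀ _ hH.ne',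
      cos_arccos (by linarith) hB1.le]
    ring
  · by_contra! hlt
    exact (hpos s ⟨by linarith, hlt⟩).ne' hzero
end

section
/- Define x(s) = √(1 + s²), z(s) = arcsinh(s), and ρ(s) = √(1 + s²) − 2s·arcsinh(s) for s ∈ ℝ. Then there exists s₂ ∈ (0, 1) with ρ(s₂) = 0, i.e. √(1 + s₂²) = 2·s₂·arcsinh(s₂); moreover ρ(−s₂) = 0, and for all s ∈ [−s₂, s₂] one has (1 + s²) + 2·(arcsinh s)² ≤ (1 + s₂²) + 2·(arcsinh s₂)². -/
/-- A numerical lower bound for `arsinh 1 = log (1 + √2)`. -/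
theorem three_quarters_lt_arsinh_one : (3 / 4 : ℝ) < Real.arsinh 1 := by
  have hsqrt : (1.4 : ℝ) < √(1 + 1 ^ 2) := Real.lt_sqrt_of_sq_lt (by norm_num)
  rw [Real.arsinh, Real.lt_log_iff_exp_lt (by positivity)]
  have hexp : Real.exp (3 / 4) < 2.4 := by
    refine lt_of_pow_lt_pow_left₀ 4 (by norm_num) ?_
    have hpow : Real.exp (3 / 4) ^ 4 = Real.exp 1 ^ 3 := by
      rw [← Real.exp_nat_mul, ← Real.exp_nat_mul]
      norm_num
    calc Real.exp (3 / 4) ^ 4 = Real.exp 1 ^ 3 := hpow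
      _ < 3 ^ 3 := by gcongr; exact Real.exp_one_lt_three
      _ < 2.4 ^ 4 := by norm_num
  linarith

/-- The free boundary catenoid in the rotational ellipsoid: there is
`s₂ ∈ (0, 1)` with `√(1 + s₂²) = 2 s₂ arcsinh(s₂)` (a zero of
`ρ(s) = √(1 + s²) - 2 s arcsinh(s)`, also at `-s₂`), and
`(1 + s²) + 2 (arcsinh s)² ≤ (1 + s₂²) + 2 (arcsinh s₂)²` for all
`s ∈ [-s₂, s₂]`. -/
theorem catenoid_free_boundary_in_ellipsoid :
    ∃ s₂ ∈ Set.Ioo (0 : ℝ) 1,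
      Real.sqrt (1 + s₂ ^ 2) - 2 * s₂ * Real.arsinh s₂ = 0 ∧
      Real.sqrt (1 + s₂ ^ 2) = 2 * s₂ * Real.arsinh s₂ ∧
      Real.sqrt (1 + (-s₂) ^ 2) - 2 * (-s₂) * Real.arsinh (-s₂) = 0 ∧
      ∀ s ∈ Set.Icc (-s₂) s₂,
        (1 + s ^ 2) + 2 * (Real.arsinh s) ^ 2 ≤
          (1 + s₂ ^ 2) + 2 * (Real.arsinh s₂) ^ 2 := by
  have hcont : ContinuousOn (fun s : ℝ => √(1 + s ^ 2) - 2 * s * Real.arsinh s)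
      (Set.Icc 0 1) := by
    have := Real.continuous_arsinh
    fun_prop
  have hone : √(1 + 1 ^ 2 : ℝ) - 2 * 1 * Real.arsinh 1 < 0 := by
    have hsqrt : √(1 + 1 ^ 2 : ℝ) < 3 / 2 := by
      rw [Real.sqrt_lt' (by norm_num)]
      norm_num
    have harsinh := three_quarters_lt_arsinh_one
    rw [mul_one, sub_neg]
    exact hsqrt.trans (by linarith)
  obtain ⟨s₂, hs₂, hzero⟩ := intermediate_value_Ioo' zero_le_one hcont
    (show (0 : ℝ) ∈ Set.Ioo _ _ from ⟨hone, by simp⟩)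
  refine ⟨s₂, hs₂, hzero, sub_eq_zero.mp hzero, ?_, fun s hs => ?_⟩
  · simpa [Real.arsinh_neg] using hzero
  · have hsq : s ^ 2 ≤ s₂ ^ 2 := sq_le_sq' hs.1 hs.2
    have harsinh : Real.arsinh s ^ 2 ≤ Real.arsinh s₂ ^ 2 := by
      refine sq_le_sq' ?_ (Real.arsinh_le_arsinh.mpr hs.2)
      rw [← Real.arsinh_neg]
      exact Real.arsinh_le_arsinh.mpr hs.1
    linarith
end

section
/- Let s₂ ∈ (0, 1) satisfy √(1 + s₂²) = 2·s₂·arcsinh(s₂). Then for all s ∈ [−s₂, s₂], the following two inequalities hold: −1 − (1/(1 + s²)^{3/2})·(√(1 + s²) − 2s·arcsinh(s)) ≤ 0 and −(s/(1 + s²))·(s·√(1 + s²) + 2·arcsinh(s)) ≤ 0. -/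
/-- For every real `s`, the product `s * arsinh s` is nonnegative. -/
theorem mul_arsinh_nonneg (s : ℝ) : 0 ≤ s * Real.arsinh s := by
  rcases le_total 0 s with h | h
  · exact mul_nonneg h (Real.arsinh_nonneg_iff.2 h)
  · exact mul_nonneg_of_nonpos_of_nonpos h (Real.arsinh_nonpos_iff.2 h)

/-- For every real `s`, the product `s * arsinh s` is at most `s ^ 2`. -/
theorem mul_arsinh_le_sq (s : ℝ) : s * Real.arsinh s ≤ s ^ 2 := by
  rw [sq]
  rcases le_total 0 s with h | h
  · refine mul_le_mul_of_nonneg_left ?_ h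
    simpa using Real.self_le_sinh_iff.2 (Real.arsinh_nonneg_iff.2 h)
  · refine mul_le_mul_of_nonpos_left ?_ h
    simpa using Real.sinh_le_self_iff.2 (Real.arsinh_nonpos_iff.2 h)

/-- The free boundary catenoid piece satisfies the hypotheses (h1) and (h3) of
the pinching lemma (with `a² = 1`, `b² = 2`): for `s₂ ∈ (0,1)` with
`√(1 + s₂²) = 2 s₂ arcsinh(s₂)` and all `s ∈ [-s₂, s₂]`,
`-1 - (1/(1+s²)^{3/2})(√(1+s²) - 2 s arcsinh s) ≤ 0` and
`-(s/(1+s²))(s √(1+s²) + 2 arcsinh s) ≤ 0`. -/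
theorem catenoid_pinching_hypotheses (s₂ : ℝ) (hs₂ : s₂ ∈ Set.Ioo (0 : ℝ) 1)
    (heq : Real.sqrt (1 + s₂ ^ 2) = 2 * s₂ * Real.arsinh s₂) :
    ∀ s ∈ Set.Icc (-s₂) s₂,
      -1 - (1 / (1 + s ^ 2) ^ ((3 : ℝ) / 2)) *
          (Real.sqrt (1 + s ^ 2) - 2 * s * Real.arsinh s) ≤ 0 ∧
      -(s / (1 + s ^ 2)) * (s * Real.sqrt (1 + s ^ 2) + 2 * Real.arsinh s) ≤ 0 := by
  intro s _
  have hpos : 0 < 1 + s ^ 2 := by positivity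
  have hw : 0 < √(1 + s ^ 2) := Real.sqrt_pos.2 hpos
  have hw_sq : √(1 + s ^ 2) ^ 2 = 1 + s ^ 2 := Real.sq_sqrt hpos.le
  constructor
  · have hpow : (1 + s ^ 2) ^ ((3 : ℝ) / 2) = √(1 + s ^ 2) ^ 3 := by
      rw [Real.sqrt_eq_rpow, ← Real.rpow_mul_natCast hpos.le]
      norm_num
    have key : 0 ≤ √(1 + s ^ 2) ^ 3 + (√(1 + s ^ 2) - 2 * s * Real.arsinh s) := by
      nlinarith [mul_arsinh_le_sq s, mul_nonneg hw.le (sq_nonneg (√(1 + s ^ 2) - 1))]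
    have hdiv := div_nonneg key (pow_pos hw 3).le
    rw [add_div, div_self (pow_pos hw 3).ne'] at hdiv
    rw [hpow, one_div_mul_eq_div]
    linarith
  · have key : 0 ≤ (s ^ 2 * √(1 + s ^ 2) + 2 * (s * Real.arsinh s)) / (1 + s ^ 2) := by
      have := mul_arsinh_nonneg s
      positivity
    calc -(s / (1 + s ^ 2)) * (s * √(1 + s ^ 2) + 2 * Real.arsinh s)
        = -((s ^ 2 * √(1 + s ^ 2) + 2 * (s * Real.arsinh s)) / (1 + s ^ 2)) := by ring
      _ ≤ 0 := neg_nonpos.2 key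
end
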